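/- arXiv:1403.1195 — 2 statements merged into one kernel-verified Lean document; each statement's English description precedes it below -/
import Mathlib

section
/- Let G be a group with a finite symmetric generating set S (e ∉ S) and let P be the lazy simple random walk measure. Suppose there are constants K, L > 0 and ν ∈ (0,1] such that |B_n| ≤ L·exp(K·n^ν) for all n ≥ 1, where B_n is the ball of radius n. Then there are constants K'', L'' > 0 such that the entropy satisfies H(P^{(n)}) ≤ L'' + K''·n^{ν/(2−ν)} for all n ≥ 1. -/
open scoped Classical

noncomputable section

/-- Word length of `g` with respect to the generating set `S`
(least `n` such that `g` is a product of `n` elements of `S`). -/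
def wordLength {G : Type*} [Group G] (S : Set G) (g : G) : ℕ :=
  sInf {n | ∃ l : List G, (∀ x ∈ l, x ∈ S) ∧ l.length = n ∧ l.prod = g}

/-- The ball of radius `n` with respect to the generating set `S`. -/
def ball {G : Type*} [Group G] (S : Set G) (n : ℕ) : Set G :=
  {g | wordLength S g ≤ n}

/-- The lazy simple random walk measure `P = (1/2)(δ_e + U_S)`. -/
def lazyWalk {G : Type*} [Group G] (S : Finset G) : G → ℝ := fun g =>
  (if g = 1 then (1 : ℝ) / 2 else 0) + (if g ∈ S then 1 / (2 * (S.card : ℝ)) else 0)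

/-- The `n`-fold convolution power of a measure `P` (with `P^{(0)} = δ_e`). -/
def convPow {G : Type*} [Group G] (P : G → ℝ) : ℕ → G → ℝ
  | 0 => fun g => if g = 1 then 1 else 0
  | n + 1 => fun g => ∑' h : G, convPow P n h * P (h⁻¹ * g)

/-- The speed (expected word length) of the walk at time `n`. -/
def speed {G : Type*} [Group G] (S : Set G) (P : G → ℝ) (n : ℕ) : ℝ :=
  ∑' g : G, convPow P n g * (wordLength S g : ℝ)

/-- The entropy of a measure `Q`, with the convention `0 · ln 0 = 0`. -/
def entropy {G : Type*} [Group G] (Q : G → ℝ) : ℝ :=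
  -∑' g : G, Q g * Real.log (Q g)

/-- A real Hilbert space equipped with an isometric linear `G`-representation and
a cocycle for it: `b (x y) = λ(x) b(y) + b(x)`. -/
structure HilbertCocycle (G : Type*) [Group G] where
  space : Type
  [nacg : NormedAddCommGroup space]
  [ips : InnerProductSpace ℝ space]
  [complete : CompleteSpace space]
  rep : G →* (space ≃ₗᵢ[ℝ] space)
  cocycle : G → space
  cocycle_rel : ∀ x y : G, cocycle (x * y) = rep x (cocycle y) + cocycle x

attribute [instance] HilbertCocycle.nacg HilbertCocycle.ips HilbertCocycle.complete

/-- The set of values at `x` of concave functions on `[0,∞)` dominating `f` on `ℕ`. -/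
def concaveMajorants (f : ℕ → ℝ) (x : ℝ) : Set ℝ :=
  {y | ∃ h : ℝ → ℝ, ConcaveOn ℝ (Set.Ici 0) h ∧ (∀ k : ℕ, f k ≤ h k) ∧ y = h x}

/-- The concave hull of `f : ℕ → ℝ`: the pointwise infimum of concave majorants. -/
def concaveHull (f : ℕ → ℝ) (x : ℝ) : ℝ := sInf (concaveMajorants f x)

/-- The log-volume of the ball of radius `n`. -/
def growthLog {G : Type*} [Group G] (S : Set G) (n : ℕ) : ℝ :=
  Real.log (Nat.card ↥(ball S n))

end

section WordLength

variable {G : Type*} [Group G]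

theorem exists_list_of_closure_eq_top {S : Set G} (hsym : ∀ s ∈ S, s⁻¹ ∈ S)
    (hgen : Subgroup.closure S = ⊤) (g : G) :
    ∃ l : List G, (∀ x ∈ l, x ∈ S) ∧ l.length = wordLength S g ∧ l.prod = g := by
  have hinv : S ∪ S⁻¹ = S := by
    refine Set.union_eq_left.2 fun s hs => ?_
    simpa using hsym _ (Set.mem_inv.1 hs)
  have hg : g ∈ Submonoid.closure S := by
    rw [← hinv, ← Subgroup.closure_toSubmonoid, hgen]
    trivial
  obtain ⟨l, hl, hprod⟩ := Submonoid.exists_list_of_mem_closure hg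
  exact Nat.sInf_mem (s := {n | ∃ l : List G, (∀ x ∈ l, x ∈ S) ∧ l.length = n ∧ l.prod = g})
    ⟨_, l, hl, rfl, hprod⟩

theorem wordLength_prod_le {S : Set G} {l : List G} (hl : ∀ x ∈ l, x ∈ S) :
    wordLength S l.prod ≤ l.length :=
  Nat.sInf_le ⟨l, hl, rfl, rfl⟩

theorem wordLength_one (S : Set G) : wordLength S 1 = 0 := by
  simpa using wordLength_prod_le (S := S) (l := []) (by simp)

theorem wordLength_le_one {S : Set G} {s : G} (hs : s ∈ S) : wordLength S s ≤ 1 := by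
  simpa using wordLength_prod_le (S := S) (l := [s]) (by simpa using hs)

theorem wordLength_mul_le {S : Set G} (hsym : ∀ s ∈ S, s⁻¹ ∈ S)
    (hgen : Subgroup.closure S = ⊤) (g h : G) :
    wordLength S (g * h) ≤ wordLength S g + wordLength S h := by
  obtain ⟨l, hl, hlen, rfl⟩ := exists_list_of_closure_eq_top hsym hgen g
  obtain ⟨l', hl', hlen', rfl⟩ := exists_list_of_closure_eq_top hsym hgen h
  rw [← hlen, ← hlen', ← List.prod_append, ← List.length_append]
  refine wordLength_prod_le fun x hx => ?_
  rcases List.mem_append.1 hx with hx | hx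
  exacts [hl x hx, hl' x hx]

theorem finite_ball {S : Set G} (hS : S.Finite) (hsym : ∀ s ∈ S, s⁻¹ ∈ S)
    (hgen : Subgroup.closure S = ⊤) (n : ℕ) : (ball S n).Finite := by
  have := hS.to_subtype
  refine ((List.finite_length_le S n).image fun l => (l.map Subtype.val).prod).subset ?_
  intro g hg
  obtain ⟨l, hl, hlen, rfl⟩ := exists_list_of_closure_eq_top hsym hgen g
  refine ⟨l.attachWith (· ∈ S) hl, ?_, by simp⟩
  simpa [hlen, ball] using hg

end WordLength

section GroupAlgebra

open MonoidAlgebra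
open Polynomial hiding coeff_sum coeff_add

variable {G : Type*} [Group G]

/-- The total mass of an element of the group algebra. -/
noncomputable def totalMass : MonoidAlgebra ℝ G →ₐ[ℝ] ℝ := MonoidAlgebra.lift ℝ ℝ G 1

theorem totalMass_eq_sum (x : MonoidAlgebra ℝ G) :
    totalMass x = ∑ g ∈ x.coeff.support, x.coeff g := by
  simp [totalMass, lift_apply, Finsupp.sum]

theorem coeff_mul_nonneg {x y : MonoidAlgebra ℝ G} (hx : ∀ g, 0 ≤ x.coeff g)
    (hy : ∀ g, 0 ≤ y.coeff g) (g : G) : 0 ≤ (x * y).coeff g := by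
  rw [coeff_mul_apply_left]
  exact Finset.sum_nonneg fun h _ => mul_nonneg (hx h) (hy _)

theorem coeff_pow_nonneg {x : MonoidAlgebra ℝ G} (hx : ∀ g, 0 ≤ x.coeff g) (n : ℕ) (g : G) :
    0 ≤ (x ^ n).coeff g := by
  induction n generalizing g with
  | zero =>
    rw [pow_zero, MonoidAlgebra.one_def, coeff_single, Finsupp.single_apply]
    split_ifs <;> simp
  | succ n ih => rw [pow_succ]; exact coeff_mul_nonneg ih hx g

theorem coeff_mul_inv {x y : MonoidAlgebra ℝ G} (hx : ∀ g, x.coeff g⁻¹ = x.coeff g)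
    (hy : ∀ g, y.coeff g⁻¹ = y.coeff g) (g : G) : (x * y).coeff g⁻¹ = (y * x).coeff g := by
  rw [coeff_mul_apply_left, coeff_mul_apply_right]
  refine Finset.sum_nbij' (·⁻¹) (·⁻¹) ?_ ?_ ?_ ?_ ?_
  · intro h; simp [hx]
  · intro h; simp [hx]
  · simp
  · simp
  · intro h _
    beta_reduce
    rw [inv_inv, ← hy (g * h), mul_inv_rev, mul_comm, hx]

theorem coeff_aeval_inv {a : MonoidAlgebra ℝ G} (ha : ∀ g, a.coeff g⁻¹ = a.coeff g)
    (p : ℝ[X]) (g : G) : (aeval a p).coeff g⁻¹ = (aeval a p).coeff g := by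
  have hpow : ∀ (n : ℕ) (g : G), (a ^ n).coeff g⁻¹ = (a ^ n).coeff g := by
    intro n
    induction n with
    | zero => intro g; simp [MonoidAlgebra.one_def, Finsupp.single_apply, eq_comm (a := (1 : G))]
    | succ n ih => intro g; rw [pow_succ, coeff_mul_inv ih ha, ← pow_succ', pow_succ]
  simp [aeval_eq_sum_range, Finsupp.finsetSum_apply, hpow]

theorem coeff_aeval_eq_zero {S : Set G} (hsym : ∀ s ∈ S, s⁻¹ ∈ S)
    (hgen : Subgroup.closure S = ⊤) {a : MonoidAlgebra ℝ G}
    (ha : ∀ g, a.coeff g ≠ 0 → wordLength S g ≤ 1) (p : ℝ[X]) {g : G}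
    (hp : p.natDegree < wordLength S g) : (aeval a p).coeff g = 0 := by
  have hpow : ∀ (n : ℕ) (g : G), (a ^ n).coeff g ≠ 0 → wordLength S g ≤ n := by
    intro n
    induction n with
    | zero =>
      intro g hg
      simp only [pow_zero, MonoidAlgebra.one_def, coeff_single, Finsupp.single_apply] at hg
      obtain rfl : 1 = g := by by_contra h; simp [h] at hg
      simp [wordLength_one]
    | succ n ih =>
      intro g hg
      rw [pow_succ, coeff_mul_apply_left] at hg
      obtain ⟨h, -, hh⟩ := Finset.exists_ne_zero_of_sum_ne_zero hg
      have := wordLength_mul_le hsym hgen h (h⁻¹ * g)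
      rw [mul_inv_cancel_left] at this
      exact this.trans (add_le_add (ih h (left_ne_zero_of_mul hh))
        (ha _ (right_ne_zero_of_mul hh)))
  rw [aeval_eq_sum_range, coeff_sum, Finsupp.finsetSum_apply]
  refine Finset.sum_eq_zero fun i hi => ?_
  rw [coeff_smul_apply, smul_eq_zero]
  right
  by_contra h
  have := hpow i g h
  have := Finset.mem_range.1 hi
  omega

/-- The squared `ℓ²` norm of an element of the group algebra. -/
noncomputable def normSq {α : Type*} (x : MonoidAlgebra ℝ α) : ℝ := ∑' g, x.coeff g ^ 2

theorem summable_coeff_sq {α : Type*} (x : MonoidAlgebra ℝ α) : Summable fun g => x.coeff g ^ 2 := by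
  refine summable_of_hasFiniteSupport (x.coeff.hasFiniteSupport.subset fun g hg => ?_)
  simpa using hg

theorem coeff_mul_self_one {x : MonoidAlgebra ℝ G} (hx : ∀ g, x.coeff g⁻¹ = x.coeff g) :
    (x * x).coeff 1 = normSq x := by
  rw [coeff_mul_apply_left, normSq, tsum_eq_sum (s := x.coeff.support) (by simp)]
  exact Finset.sum_congr rfl fun g _ => by beta_reduce; rw [mul_one, hx, sq]

theorem normSq_mul_le {a : MonoidAlgebra ℝ G} (ha : ∀ g, 0 ≤ a.coeff g)
    (hmass : totalMass a = 1) (x : MonoidAlgebra ℝ G) : normSq (a * x) ≤ normSq x := by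
  have htrans (h : G) : ∑' g, x.coeff (h⁻¹ * g) ^ 2 = normSq x :=
    (Equiv.mulLeft h⁻¹).tsum_eq fun g => x.coeff g ^ 2
  have hsum (h : G) : Summable fun g => a.coeff h * x.coeff (h⁻¹ * g) ^ 2 :=
    (((Equiv.mulLeft h⁻¹).summable_iff (f := fun g => x.coeff g ^ 2)).2
      (summable_coeff_sq x)).mul_left _
  rw [totalMass_eq_sum] at hmass
  calc normSq (a * x)
      ≤ ∑' g, ∑ h ∈ a.coeff.support, a.coeff h * x.coeff (h⁻¹ * g) ^ 2 := by
        refine (summable_coeff_sq _).tsum_le_tsum (fun g => ?_) (summable_sum fun h _ => hsum h)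
        rw [coeff_mul_apply_left]
        exact (even_two.convexOn_pow (𝕜 := ℝ)).map_sum_le (fun h _ => ha h) hmass
          (fun _ _ => Set.mem_univ _)
    _ = ∑ h ∈ a.coeff.support, a.coeff h * normSq x := by
        rw [Summable.tsum_finsetSum fun h _ => hsum h]
        exact Finset.sum_congr rfl fun h _ => by rw [tsum_mul_left, htrans]
    _ = normSq x := by rw [← Finset.sum_mul, hmass, one_mul]

theorem chebyshev_pell (n : ℕ) :
    Chebyshev.T ℝ n ^ 2 + (1 - X ^ 2) * Chebyshev.U ℝ (n - 1) ^ 2 = 1 := by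
  induction n with
  | zero => simp
  | succ n ih =>
    have hT := Chebyshev.T_eq_X_mul_T_sub_pol_U ℝ ((n : ℤ) - 1)
    have hU := Chebyshev.U_eq_X_mul_U_add_T ℝ ((n : ℤ) - 1)
    rw [show (n : ℤ) - 1 + 2 = n + 1 by ring, sub_add_cancel] at hT
    rw [sub_add_cancel] at hU
    push_cast
    rw [add_sub_cancel_right, hT, hU]
    linear_combination ih

theorem abs_coeff_aeval_T_le_one {a : MonoidAlgebra ℝ G} (ha : ∀ g, 0 ≤ a.coeff g)
    (hmass : totalMass a = 1) (hinv : ∀ g, a.coeff g⁻¹ = a.coeff g) (k : ℤ) (g : G) :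
    |(aeval a (Chebyshev.T ℝ k)).coeff g| ≤ 1 := by
  rw [← Chebyshev.T_natAbs]
  generalize k.natAbs = n
  set t := aeval a (Chebyshev.T ℝ n) with ht
  set U := Chebyshev.U ℝ ((n : ℤ) - 1) with hU
  have hpell : t * t + aeval a U * aeval a U = 1 + aeval a (X * U) * aeval a (X * U) := by
    rw [ht, ← map_mul, ← map_mul, ← map_mul, ← map_one (aeval (R := ℝ) a), ← map_add, ← map_add]
    congr 1
    linear_combination chebyshev_pell n
  have hone := congrArg (fun x => x.coeff 1) hpell
  simp only [coeff_add, Finsupp.add_apply, coeff_one_one] at hone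
  rw [coeff_mul_self_one (coeff_aeval_inv hinv _), coeff_mul_self_one (coeff_aeval_inv hinv _),
    coeff_mul_self_one (coeff_aeval_inv hinv _)] at hone
  have hcontr : normSq (aeval a (X * U)) ≤ normSq (aeval a U) := by
    rw [map_mul, aeval_X]
    exact normSq_mul_le ha hmass _
  have hle : t.coeff g ^ 2 ≤ normSq t :=
    (summable_coeff_sq t).le_tsum g fun _ _ => sq_nonneg _
  rw [← sq_le_one_iff_abs_le_one]
  linarith

/-- The Varopoulos–Carne bound. -/
theorem coeff_pow_le_exp {S : Set G} (hsym : ∀ s ∈ S, s⁻¹ ∈ S)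
    (hgen : Subgroup.closure S = ⊤) {a : MonoidAlgebra ℝ G} (ha : ∀ g, 0 ≤ a.coeff g)
    (hmass : totalMass a = 1) (hinv : ∀ g, a.coeff g⁻¹ = a.coeff g)
    (hlen : ∀ g, a.coeff g ≠ 0 → wordLength S g ≤ 1) {n : ℕ} (hn : n ≠ 0) (g : G) :
    (a ^ n).coeff g ≤ 2 * Real.exp (-((wordLength S g : ℝ) ^ 2 / (2 * n))) := by
  set d : ℝ := (wordLength S g : ℝ) with hd
  set c : ℝ := d / n with hc
  have hn' : (0 : ℝ) < n := by positivity
  have hc0 : 0 ≤ c := by positivity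
  have key : ∀ (m : ℕ) (k : ℤ), |(a ^ m * aeval a (Chebyshev.T ℝ k)).coeff g| ≤
      Real.cosh c ^ m * Real.cosh (c * k) / Real.cosh (c * d) := by
    intro m
    induction m with
    | zero =>
      intro k
      rw [pow_zero, pow_zero, one_mul, one_mul]
      rcases lt_or_ge k.natAbs (wordLength S g) with h | h
      · rw [coeff_aeval_eq_zero hsym hgen hlen _ (by rwa [Chebyshev.natDegree_T]), abs_zero]
        positivity
      · refine (abs_coeff_aeval_T_le_one ha hmass hinv k g).trans ?_
        rw [one_le_div (Real.cosh_pos _), Real.cosh_le_cosh, abs_mul, abs_mul]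
        have : |d| ≤ |(k : ℝ)| := by
          rw [hd, Nat.abs_cast, ← Int.cast_abs, Int.abs_eq_natAbs]
          exact_mod_cast h
        gcongr
    | succ m ih =>
      intro k
      have hrec : a ^ (m + 1) * aeval a (Chebyshev.T ℝ k) = (1 / 2 : ℝ) •
          (a ^ m * aeval a (Chebyshev.T ℝ (k + 1)) + a ^ m * aeval a (Chebyshev.T ℝ (k - 1))) := by
        rw [← mul_add, ← map_add, Chebyshev.T_add_one, sub_add_cancel, mul_assoc, map_mul,
          map_mul, aeval_X, map_ofNat, pow_succ, mul_assoc, two_mul, mul_add, ← two_smul ℝ,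
          smul_smul]
        norm_num
      have h1 := ih (k + 1)
      have h2 := ih (k - 1)
      have hadd : Real.cosh (c * (k + 1)) + Real.cosh (c * (k - 1)) =
          2 * Real.cosh c * Real.cosh (c * k) := by
        rw [mul_add, mul_sub, mul_one, Real.cosh_add, Real.cosh_sub]
        ring
      push_cast at h1 h2
      rw [hrec, coeff_smul_apply, coeff_add, Finsupp.add_apply, smul_eq_mul, abs_mul,
        abs_of_pos (by norm_num : (0 : ℝ) < 1 / 2)]
      calc _ ≤ 1 / 2 * (Real.cosh c ^ m * Real.cosh (c * (k + 1)) / Real.cosh (c * d) +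
            Real.cosh c ^ m * Real.cosh (c * (k - 1)) / Real.cosh (c * d)) := by
            gcongr
            exact (abs_add_le _ _).trans (add_le_add h1 h2)
        _ = _ := by
            rw [← add_div, ← mul_add, hadd]
            ring
  have h0 := key n 0
  rw [Chebyshev.T_zero, map_one, mul_one, Int.cast_zero, mul_zero, Real.cosh_zero, mul_one] at h0
  have hcosh : Real.exp (c * d) ≤ 2 * Real.cosh (c * d) := by
    rw [Real.cosh_eq]
    linarith [Real.exp_pos (-(c * d))]
  calc (a ^ n).coeff g ≤ Real.cosh c ^ n / Real.cosh (c * d) := (le_abs_self _).trans h0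
    _ ≤ Real.exp (c ^ 2 / 2) ^ n / (Real.exp (c * d) / 2) := by
        gcongr
        · exact Real.cosh_le_exp_half_sq c
        · linarith
    _ = 2 * Real.exp (-(d ^ 2 / (2 * n))) := by
        rw [← Real.exp_nat_mul, div_div_eq_mul_div, mul_comm, mul_div_assoc, ← Real.exp_sub]
        congr 2
        rw [hc]
        field_simp
        ring

end GroupAlgebra

section LazyWalk

open MonoidAlgebra

variable {G : Type*} [Group G]

/-- The lazy simple random walk measure as an element of the group algebra. -/
noncomputable def lazyWalkElement (S : Finset G) : MonoidAlgebra ℝ G :=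
  single 1 (1 / 2) + ∑ s ∈ S, single s (1 / (2 * (S.card : ℝ)))

theorem coeff_lazyWalkElement (S : Finset G) (g : G) :
    (lazyWalkElement S).coeff g = lazyWalk S g := by
  simp [lazyWalkElement, lazyWalk, Finsupp.single_apply, eq_comm (a := (1 : G))]

theorem lazyWalk_nonneg (S : Finset G) (g : G) : 0 ≤ lazyWalk S g := by
  unfold lazyWalk
  positivity

theorem totalMass_lazyWalkElement {S : Finset G} (hS : S.Nonempty) :
    totalMass (lazyWalkElement S) = 1 := by
  have : (S.card : ℝ) ≠ 0 := by exact_mod_cast hS.card_pos.ne'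
  simp only [lazyWalkElement, totalMass, map_add, map_sum, lift_single, MonoidHom.one_apply,
    smul_eq_mul, mul_one, Finset.sum_const, nsmul_eq_mul]
  field_simp
  norm_num

theorem lazyWalk_inv {S : Finset G} (hsym : ∀ s ∈ S, s⁻¹ ∈ S) (g : G) :
    lazyWalk S g⁻¹ = lazyWalk S g := by
  have : g⁻¹ ∈ S ↔ g ∈ S := ⟨fun h => by simpa using hsym _ h, hsym g⟩
  simp [lazyWalk, this]

theorem wordLength_le_one_of_lazyWalk_ne_zero {S : Finset G} {g : G} (hg : lazyWalk S g ≠ 0) :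
    wordLength (S : Set G) g ≤ 1 := by
  by_cases h1 : g = 1
  · simp [h1, wordLength_one]
  by_cases h2 : g ∈ S
  · exact wordLength_le_one (Finset.mem_coe.2 h2)
  · simp [lazyWalk, h1, h2] at hg

theorem convPow_coeff (a : MonoidAlgebra ℝ G) (n : ℕ) (g : G) :
    convPow a.coeff n g = (a ^ n).coeff g := by
  induction n generalizing g with
  | zero => simp [convPow, MonoidAlgebra.one_def, Finsupp.single_apply, eq_comm (a := (1 : G))]
  | succ n ih =>
    rw [pow_succ, coeff_mul_apply_left, convPow]
    beta_reduce
    rw [tsum_eq_sum (s := (a ^ n).coeff.support)]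
    · exact Finset.sum_congr rfl fun h _ => by rw [ih]
    · intro h hh
      rw [ih, Finsupp.notMem_support_iff.1 hh, zero_mul]

end LazyWalk

section Entropy

variable {G : Type*} [Group G]

theorem entropy_eq_sum (q : G →₀ ℝ) :
    entropy q = ∑ g ∈ q.support, -(q g * Real.log (q g)) := by
  rw [entropy, tsum_eq_sum (s := q.support) (by simp +contextual), Finset.sum_neg_distrib]

/-- Gibbs' inequality against the unnormalised weight `exp (-f)`. -/
theorem entropy_le_sum_add {q : G →₀ ℝ} (hq : ∀ g, 0 ≤ q g)
    (hmass : ∑ g ∈ q.support, q g = 1) (f : G → ℝ) :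
    entropy q ≤ ∑ g ∈ q.support, q g * f g + ∑ g ∈ q.support, Real.exp (-f g) - 1 := by
  rw [entropy_eq_sum, ← hmass, ← Finset.sum_add_distrib, ← Finset.sum_sub_distrib]
  refine Finset.sum_le_sum fun g hg => ?_
  have hpos : 0 < q g := (hq g).lt_of_ne' (Finsupp.mem_support_iff.1 hg)
  have hlog := Real.log_le_sub_one_of_pos (div_pos (Real.exp_pos (-f g)) hpos)
  rw [Real.log_div (Real.exp_pos _).ne' hpos.ne', Real.log_exp] at hlog
  have hmul := mul_le_mul_of_nonneg_left hlog hpos.le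
  rw [mul_sub, mul_sub, mul_div_cancel₀ _ hpos.ne'] at hmul
  linarith

theorem sum_sub_log_le_entropy {q : G →₀ ℝ} (hq : ∀ g, 0 ≤ q g)
    (hmass : ∑ g ∈ q.support, q g = 1) {f : G → ℝ} {c : ℝ} (hc : 0 < c)
    (hqf : ∀ g, q g ≤ c * Real.exp (-f g)) :
    ∑ g ∈ q.support, q g * f g - Real.log c ≤ entropy q := by
  rw [entropy_eq_sum, ← one_mul (Real.log c), ← hmass, Finset.sum_mul, ← Finset.sum_sub_distrib]
  refine Finset.sum_le_sum fun g hg => ?_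
  have hpos : 0 < q g := (hq g).lt_of_ne' (Finsupp.mem_support_iff.1 hg)
  have hlog := Real.log_le_log hpos (hqf g)
  rw [Real.log_mul hc.ne' (Real.exp_pos _).ne', Real.log_exp] at hlog
  nlinarith

end Entropy

theorem summable_exp_neg_natCast_rpow {ν : ℝ} (hν : 0 < ν) :
    Summable fun n : ℕ => Real.exp (-(n : ℝ) ^ ν) := by
  have h := ((isLittleO_exp_neg_mul_rpow_atTop one_pos (-2 / ν)).comp_tendsto
    ((tendsto_rpow_atTop hν).comp tendsto_natCast_atTop_atTop)).isBigO
  refine summable_of_isBigO_nat (Real.summable_nat_rpow.2 (by norm_num : (-2 : ℝ) < -1)) ?_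
  refine (h.congr (fun n => ?_) fun n => ?_)
  · simp
  · simp only [Function.comp_apply]
    rw [← Real.rpow_mul n.cast_nonneg, mul_div_cancel₀ _ hν.ne']

theorem sum_exp_neg_wordLength_le {G : Type*} [Group G] {S : Set G} (hS : S.Finite)
    (hsym : ∀ s ∈ S, s⁻¹ ∈ S) (hgen : Subgroup.closure S = ⊤) {w : ℕ → ℝ} (hw : ∀ n, 0 ≤ w n)
    (hsum : Summable fun n => (Nat.card (ball S n) : ℝ) * w n) (F : Finset G) :
    ∑ g ∈ F, w (wordLength S g) ≤ ∑' n, (Nat.card (ball S n) : ℝ) * w n := by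
  rw [← Finset.sum_fiberwise_of_maps_to (t := F.image (wordLength S))
    fun g hg => Finset.mem_image_of_mem _ hg]
  refine le_trans (Finset.sum_le_sum fun n _ => ?_)
    (hsum.sum_le_tsum _ fun n _ => mul_nonneg (Nat.cast_nonneg _) (hw n))
  rw [Finset.sum_congr rfl fun g hg => by rw [(Finset.mem_filter.1 hg).2], Finset.sum_const,
    nsmul_eq_mul]
  gcongr
  · exact hw n
  · rw [Nat.card_coe_set_eq, ← Set.ncard_coe_finset]
    refine Set.ncard_le_ncard (fun g hg => ?_) (finite_ball hS hsym hgen n)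
    exact (Finset.mem_filter.1 (Finset.mem_coe.1 hg)).2.le

theorem rpow_le_rpow_add_mul_sq {ν r x : ℝ} (hν0 : 0 < ν) (hν2 : ν ≤ 2) (hr : 0 < r)
    (hx : 0 ≤ x) : x ^ ν ≤ r ^ ν + r ^ (ν - 2) * x ^ 2 := by
  rcases le_total x r with h | h
  · exact (Real.rpow_le_rpow hx h hν0.le).trans (le_add_of_nonneg_right (by positivity))
  · have hx0 : 0 < x := hr.trans_le h
    calc x ^ ν = x ^ (ν - 2) * x ^ 2 := by
          rw [← Real.rpow_natCast, ← Real.rpow_add hx0]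
          norm_num
      _ ≤ r ^ (ν - 2) * x ^ 2 := by
          gcongr ?_ * _
          exact Real.rpow_le_rpow_of_nonpos hr h (by linarith)
      _ ≤ _ := le_add_of_nonneg_left (by positivity)

/-- if `|B_n| ≤ L·exp(K·n^ν)` then the entropy satisfies
`H(P^{(n)}) ≤ L'' + K''·n^{ν/(2−ν)}`. -/
theorem stmt4 {G : Type*} [Group G] (S : Finset G)
    (hS1 : (1 : G) ∉ S) (hSne : S.Nonempty) (hsym : ∀ s ∈ S, s⁻¹ ∈ S)
    (hgen : Subgroup.closure (S : Set G) = ⊤)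
    (K L ν : ℝ) (hK : 0 < K) (hL : 0 < L) (hν0 : 0 < ν) (hν1 : ν ≤ 1)
    (hvol : ∀ n : ℕ, 1 ≤ n →
      (Nat.card ↥(ball (S : Set G) n) : ℝ) ≤ L * Real.exp (K * (n : ℝ) ^ ν)) :
    ∃ K'' L'' : ℝ, 0 < K'' ∧ 0 < L'' ∧ ∀ n : ℕ, 1 ≤ n →
      entropy (convPow (lazyWalk S) n) ≤ L'' + K'' * (n : ℝ) ^ (ν / (2 - ν)) := by
  set A : ℝ := K + 1 with hA
  have hApos : 0 < A := by positivity
  set w : ℕ → ℝ := fun n => Real.exp (-(A * (n : ℝ) ^ ν)) with hw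
  have hsum : Summable fun n => (Nat.card (ball (S : Set G) n) : ℝ) * w n := by
    rw [← summable_nat_add_iff 1]
    refine Summable.of_nonneg_of_le (fun n => by positivity) (fun n => ?_)
      (((summable_nat_add_iff 1).2 (summable_exp_neg_natCast_rpow hν0)).mul_left L)
    calc _ ≤ L * Real.exp (K * ((n + 1 : ℕ) : ℝ) ^ ν) * w (n + 1) := by
          gcongr
          exact hvol _ n.succ_pos
      _ = _ := by
          rw [hw, mul_assoc, ← Real.exp_add, hA]
          ring_nf
  set Z := ∑' n, (Nat.card (ball (S : Set G) n) : ℝ) * w n with hZ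
  have hZ0 : 0 ≤ Z := tsum_nonneg fun n => by positivity
  have hlog2 : 0 < Real.log 2 := Real.log_pos one_lt_two
  refine ⟨2 * A * (4 * A) ^ (ν / (2 - ν)), 2 * Z + Real.log 2, by positivity, by positivity,
    fun n hn => ?_⟩
  have hn0 : (0 : ℝ) < n := by exact_mod_cast hn
  set a := lazyWalkElement S
  have hwalk : ⇑a.coeff = lazyWalk S := funext (coeff_lazyWalkElement S)
  have ha : ∀ g, 0 ≤ a.coeff g := fun g => by rw [hwalk]; exact lazyWalk_nonneg S g
  have hmass := totalMass_lazyWalkElement hSne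
  set q := (a ^ n).coeff with hq
  have hqconv : convPow (lazyWalk S) n = q := by
    rw [← hwalk]
    exact funext (convPow_coeff a n)
  have hq0 : ∀ g, 0 ≤ q g := coeff_pow_nonneg ha n
  have hq1 : ∑ g ∈ q.support, q g = 1 := by
    rw [hq, ← totalMass_eq_sum, map_pow, hmass, one_pow]
  rw [hqconv]
  set ℓ : G → ℝ := fun g => (wordLength (S : Set G) g : ℝ)
  set M := ∑ g ∈ q.support, q g * ℓ g ^ 2 with hM
  have hlower : M / (2 * n) - Real.log 2 ≤ entropy q := by
    have h := sum_sub_log_le_entropy hq0 hq1 two_pos fun g =>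
      coeff_pow_le_exp hsym hgen ha hmass (fun g => by rw [hwalk, lazyWalk_inv hsym])
        (fun g hg => wordLength_le_one_of_lazyWalk_ne_zero (hwalk ▸ hg)) (by lia) g
    rw [hM, Finset.sum_div]
    simpa only [mul_div_assoc] using h
  have hupper : entropy q ≤ A * ∑ g ∈ q.support, q g * ℓ g ^ ν + Z := by
    have h := entropy_le_sum_add hq0 hq1 fun g => A * ℓ g ^ ν
    have hZle := sum_exp_neg_wordLength_le S.finite_toSet hsym hgen (fun n => (Real.exp_pos _).le)
      hsum q.support
    have hcomm : ∑ g ∈ q.support, q g * (A * ℓ g ^ ν) = A * ∑ g ∈ q.support, q g * ℓ g ^ ν := by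
      rw [Finset.mul_sum]
      exact Finset.sum_congr rfl fun g _ => by ring
    linarith
  set r : ℝ := (4 * A * n) ^ (1 / (2 - ν)) with hr
  have hr0 : 0 < r := by positivity
  have h2ν : 2 - ν ≠ 0 := by linarith
  have hrν : r ^ ν = (4 * A) ^ (ν / (2 - ν)) * (n : ℝ) ^ (ν / (2 - ν)) := by
    rw [hr, ← Real.rpow_mul (by positivity), ← Real.mul_rpow (by positivity) hn0.le]
    ring_nf
  have hrν2 : r ^ (ν - 2) = (4 * A * n)⁻¹ := by
    rw [hr, ← Real.rpow_mul (by positivity), ← Real.rpow_neg_one]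
    congr 1
    field_simp
    ring
  have hmoment : ∑ g ∈ q.support, q g * ℓ g ^ ν ≤ r ^ ν + (4 * A * n)⁻¹ * M := by
    rw [hM, ← one_mul (r ^ ν), ← hq1, Finset.sum_mul, Finset.mul_sum, ← Finset.sum_add_distrib]
    refine Finset.sum_le_sum fun g _ => ?_
    have h := mul_le_mul_of_nonneg_left
      (rpow_le_rpow_add_mul_sq hν0 (by linarith) hr0 (Nat.cast_nonneg (wordLength (S : Set G) g)))
      (hq0 g)
    rw [hrν2] at h
    linarith
  have hhalf : A * ((4 * A * n)⁻¹ * M) = M / (2 * n) / 2 := by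
    field_simp
    ring
  have hAmoment := mul_le_mul_of_nonneg_left hmoment hApos.le
  rw [mul_add, hhalf, hrν] at hAmoment
  linarith
end

section
/- Let G be a group with a finite symmetric generating set S (e ∉ S), with word length |·|, and let P be a finitely supported probability measure on G. Suppose there are constants M, N > 0 such that P^{(n)}(g) ≤ N·exp(−M·|g|²/n) for all g ∈ G and all n ≥ 1. Then for every n ≥ 1, H(P^{(n)}) ≥ −ln N + (M/n)·(E|P^{(n)}|)², where E|P^{(n)}| = Σ_{g∈G} P^{(n)}(g)·|g|. -/
open scoped Classical

theorem convPow_nonneg {G : Type*} [Group G] {P : G → ℝ} (hP : ∀ g, 0 ≤ P g) (n : ℕ) (g : G) :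
    0 ≤ convPow P n g := by
  induction n generalizing g with
  | zero => unfold convPow; split_ifs <;> norm_num
  | succ n ih => exact tsum_nonneg fun h => mul_nonneg (ih h) (hP _)

open scoped Pointwise in
theorem finite_support_convPow {G : Type*} [Group G] {P : G → ℝ}
    (hP : (Function.support P).Finite) (n : ℕ) : (Function.support (convPow P n)).Finite := by
  induction n with
  | zero =>
    refine (Set.finite_singleton (1 : G)).subset fun g hg => ?_
    by_contra h
    exact hg (if_neg h)
  | succ n ih =>
    refine (ih.mul hP).subset fun g hg => ?_
    by_contra h
    refine hg (Eq.trans (tsum_congr fun x => ?_) tsum_zero)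
    by_contra hx
    exact h ⟨x, left_ne_zero_of_mul hx, x⁻¹ * g, right_ne_zero_of_mul hx, mul_inv_cancel_left x g⟩

theorem hasSum_convPow {G : Type*} [Group G] {P : G → ℝ} (hpos : ∀ g, 0 ≤ P g)
    (hP : HasSum P 1) (n : ℕ) : HasSum (convPow P n) 1 := by
  induction n with
  | zero => exact hasSum_ite_eq (1 : G) (1 : ℝ)
  | succ n ih =>
    let e : G × G ≃ G × G :=
      { toFun := fun x => (x.2, x.2⁻¹ * x.1)
        invFun := fun x => (x.1 * x.2, x.1)
        left_inv := fun x => by simp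
        right_inv := fun x => by simp }
    have hprod : HasSum (fun x : G × G => convPow P n x.1 * P x.2) 1 := by
      simpa using ih.mul hP
        (ih.summable.mul_of_nonneg hP.summable (convPow_nonneg hpos n) hpos)
    have he := e.hasSum_iff.mpr hprod
    exact he.prod_fiberwise fun g => (he.summable.prod_factor g).hasSum

/-- A weighted power-mean inequality: the square of the mean is at most the mean square. -/
theorem sq_sum_mul_le_sum_mul_sq {ι : Type*} (t : Finset ι) {p : ι → ℝ} (w : ι → ℝ)
    (hp : ∀ i ∈ t, 0 ≤ p i) (hsum : ∑ i ∈ t, p i = 1) :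
    (∑ i ∈ t, p i * w i) ^ 2 ≤ ∑ i ∈ t, p i * w i ^ 2 := by
  have h := Finset.sum_sq_le_sum_mul_sum_of_sq_le_mul t (r := fun i => p i * w i)
    (g := fun i => p i * w i ^ 2) hp (fun i hi => mul_nonneg (hp i hi) (sq_nonneg _))
    (fun i _ => le_of_eq (by ring))
  rwa [hsum, one_mul] at h

/-- A finitely supported probability with Gaussian decay `Q g ≤ N exp (-c (w g)²)` has entropy
at least `-log N + c (∑ Q g * w g)²`. -/
theorem le_entropy_of_le_exp {G : Type*} [Group G] {Q : G → ℝ} (w : G → ℝ) {c N : ℝ}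
    (hfin : (Function.support Q).Finite) (hpos : ∀ g, 0 ≤ Q g) (hsum : HasSum Q 1)
    (hc : 0 ≤ c) (hN : 0 < N) (hQ : ∀ g, Q g ≤ N * Real.exp (-(c * w g ^ 2))) :
    -Real.log N + c * (∑' g, Q g * w g) ^ 2 ≤ entropy Q := by
  set t := hfin.toFinset with ht
  have hzero : ∀ g ∉ t, Q g = 0 := fun g hg => by simpa [ht] using hg
  have hone : ∑ g ∈ t, Q g = 1 := (hasSum_sum_of_ne_finset_zero hzero).unique hsum
  rw [entropy, tsum_eq_sum (s := t) fun g hg => by rw [hzero g hg, zero_mul],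
    tsum_eq_sum (s := t) fun g hg => by rw [hzero g hg, zero_mul]]
  have hlog : ∑ g ∈ t, Q g * Real.log (Q g) ≤ ∑ g ∈ t, Q g * (Real.log N - c * w g ^ 2) := by
    refine Finset.sum_le_sum fun g hg => mul_le_mul_of_nonneg_left ?_ (hpos g)
    have hQg : 0 < Q g := (hpos g).lt_of_ne' (by simpa [ht] using hg)
    calc Real.log (Q g) ≤ Real.log (N * Real.exp (-(c * w g ^ 2))) := Real.log_le_log hQg (hQ g)
      _ = Real.log N - c * w g ^ 2 := by
        rw [Real.log_mul hN.ne' (Real.exp_ne_zero _), Real.log_exp, sub_eq_add_neg]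
  have hexpand : ∑ g ∈ t, Q g * (Real.log N - c * w g ^ 2)
      = Real.log N - c * ∑ g ∈ t, Q g * w g ^ 2 := by
    simp only [mul_sub, Finset.sum_sub_distrib, ← Finset.sum_mul, hone, one_mul,
      Finset.mul_sum, mul_left_comm]
  have hsq := mul_le_mul_of_nonneg_left
    (sq_sum_mul_le_sum_mul_sq t w (fun g _ => hpos g) hone) hc
  linarith

/-- if `P^{(n)}(g) ≤ N exp(−M|g|²/n)` then
`H(P^{(n)}) ≥ −ln N + (M/n)(E|P^{(n)}|)²`. -/
theorem stmt12 {G : Type*} [Group G] (S : Finset G)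
    (hS1 : (1 : G) ∉ S) (hSne : S.Nonempty) (hsym : ∀ s ∈ S, s⁻¹ ∈ S)
    (hgen : Subgroup.closure (S : Set G) = ⊤)
    (P : G → ℝ) (hfin : (Function.support P).Finite) (hpos : ∀ g : G, 0 ≤ P g)
    (hsum : ∑' g : G, P g = 1)
    (M N : ℝ) (hM : 0 < M) (hN : 0 < N)
    (hOD : ∀ (g : G) (n : ℕ), 1 ≤ n →
      convPow P n g ≤ N * Real.exp (-M * (wordLength (S : Set G) g : ℝ) ^ 2 / (n : ℝ))) :
    ∀ n : ℕ, 1 ≤ n →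
      -Real.log N + M / (n : ℝ) * (speed (S : Set G) P n) ^ 2 ≤
        entropy (convPow P n) := by
  intro n hn
  have hP : HasSum P 1 := hsum ▸ (summable_of_hasFiniteSupport hfin).hasSum
  refine le_entropy_of_le_exp _ (finite_support_convPow hfin n) (convPow_nonneg hpos n)
    (hasSum_convPow hpos hP n) (by positivity) hN fun g => (hOD g n hn).trans_eq ?_
  ring_nf
end
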